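/- Let n ≥ 1 and σ > 0, let 𝒜* be a finite nonempty set of n×n real matrices closed under the conjugation action of permutations, and let p*(X) = (1/|𝒜*|) Σ_{A ∈ 𝒜*} (2πσ²)^(−n²/2) exp(−‖X − A‖_F² / (2σ²)). Then log p* is differentiable everywhere on ℝ^(n×n) (with respect to the Frobenius inner product), and its gradient is permutation equivariant: ∇ log p*(τ • X) = τ • (∇ log p*(X)) for every permutation τ of Fin n and every X. -/

import Mathlib

/-- Conjugation action of a permutation on `ℝ^(n×n)` with the Frobenius inner product
(`EuclideanSpace ℝ (Fin n × Fin n)`): `(τ • X) (i, j) = X (τ⁻¹ i, τ⁻¹ j)`. -/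
noncomputable def permConjE {n : ℕ} (τ : Equiv.Perm (Fin n))
    (X : EuclideanSpace ℝ (Fin n × Fin n)) : EuclideanSpace ℝ (Fin n × Fin n) :=
  (WithLp.equiv 2 (Fin n × Fin n → ℝ)).symm (fun p => X (τ⁻¹ p.1, τ⁻¹ p.2))

/-- If `𝒜*` is a finite nonempty set of `n × n` real matrices closed under conjugation
by permutations and `p*(X) = (1/|𝒜*|) ∑_{A ∈ 𝒜*} (2πσ²)^(−n²/2) exp(−‖X−A‖_F²/(2σ²))`,
then `log p*` is differentiable everywhere and its gradient (w.r.t. the Frobenius inner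
product) is permutation equivariant: `∇ log p*(τ • X) = τ • ∇ log p*(X)`. -/
theorem stmt12 (n : ℕ) (hn : 1 ≤ n) (σ : ℝ) (hσ : 0 < σ)
    (𝒜star : Finset (EuclideanSpace ℝ (Fin n × Fin n))) (h0 : 𝒜star.Nonempty)
    (hclosed : ∀ (τ : Equiv.Perm (Fin n)) (A), A ∈ 𝒜star → permConjE τ A ∈ 𝒜star)
    (pstar : EuclideanSpace ℝ (Fin n × Fin n) → ℝ)
    (hpstar : ∀ X, pstar X = ((𝒜star.card : ℝ))⁻¹ *
      ∑ A ∈ 𝒜star, (2 * Real.pi * σ ^ 2) ^ (-((n : ℝ) ^ 2) / 2) *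
        Real.exp (-‖X - A‖ ^ 2 / (2 * σ ^ 2))) :
    (∀ X, DifferentiableAt ℝ (fun Y => Real.log (pstar Y)) X) ∧
    (∀ (τ : Equiv.Perm (Fin n)) (X),
      gradient (fun Y => Real.log (pstar Y)) (permConjE τ X) =
        permConjE τ (gradient (fun Y => Real.log (pstar Y)) X)) := by
  have hc : (0 : ℝ) < (2 * Real.pi * σ ^ 2) ^ (-((n : ℝ) ^ 2) / 2) := by positivity
  have hcard : (0 : ℝ) < 𝒜star.card := by exact_mod_cast h0.card_pos
  have hpos : ∀ X, 0 < pstar X := by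
    intro X
    rw [hpstar]
    refine mul_pos (inv_pos.mpr hcard) (Finset.sum_pos (fun A _ => ?_) h0)
    exact mul_pos hc (Real.exp_pos _)
  have hdiff : ∀ X, DifferentiableAt ℝ (fun Y => Real.log (pstar Y)) X := by
    intro X
    refine DifferentiableAt.log ?_ (hpos X).ne'
    rw [funext hpstar]
    refine DifferentiableAt.const_mul ?_ _
    refine DifferentiableAt.fun_sum fun A _ => ?_
    refine DifferentiableAt.const_mul ?_ _
    refine DifferentiableAt.exp ?_
    simp only [div_eq_mul_inv]
    refine DifferentiableAt.mul_const ?_ _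
    exact ((differentiableAt_id.sub_const A).norm_sq ℝ).neg
  refine ⟨hdiff, fun τ X => ?_⟩
  let L : EuclideanSpace ℝ (Fin n × Fin n) ≃ₗᵢ[ℝ] EuclideanSpace ℝ (Fin n × Fin n) :=
    LinearIsometryEquiv.piLpCongrLeft 2 ℝ ℝ (Equiv.prodCongr τ τ)
  have hL : ∀ Y, permConjE τ Y = L Y := by
    intro Y
    ext p
    rfl
  have hinv : ∀ Y, pstar (L Y) = pstar Y := by
    intro Y
    rw [hpstar, hpstar]
    congr 1
    symm
    have hmaps : ∀ A ∈ 𝒜star, L A ∈ 𝒜star := fun A hA => hL A ▸ hclosed τ A hA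
    refine Finset.sum_bij (fun A _ => L A) hmaps (fun A _ B _ h => L.injective h) ?_ ?_
    · intro B hB
      obtain ⟨A, hA, h⟩ := Finset.surj_on_of_inj_on_of_card_le (fun A _ => L A) hmaps
        (fun A B _ _ h => L.injective h) le_rfl B hB
      exact ⟨A, hA, h.symm⟩
    · intro A _
      rw [← map_sub, L.norm_map]
  rw [hL, hL]
  refine HasGradientAt.gradient ?_
  have hg := (hdiff X).hasGradientAt.hasFDerivAt
  rw [hasGradientAt_iff_hasFDerivAt]
  have hX : X = L.symm (L X) := (L.symm_apply_apply X).symm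
  have h1 := HasFDerivAt.comp (L X) (hX ▸ hg)
    (L.symm.toContinuousLinearEquiv.hasFDerivAt (x := L X))
  have hf : (fun Y => Real.log (pstar Y)) ∘ L.symm.toContinuousLinearEquiv
      = fun Y => Real.log (pstar Y) := by
    funext Y
    have := hinv (L.symm Y)
    rw [L.apply_symm_apply] at this
    simp [this]
  rw [hf] at h1
  refine h1.congr_fderiv ?_
  apply ContinuousLinearMap.ext
  intro v
  rw [← hX]
  symm
  change inner ℝ (L (gradient (fun Y => Real.log (pstar Y)) X)) v =
    inner ℝ (gradient (fun Y => Real.log (pstar Y)) X) (L.symm v)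
  exact L.inner_map_eq_flip _ _
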